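/- For every y ∈ ℂ with |Im y| < π and every ε ∈ (0, π), the integral ∫_ℝ e^{-i·y·(v+iε)/π} / (4·(v+iε)²·sinh(v+iε)) dv converges absolutely and equals (-i/(2π))·Li₂(-e^{y}). -/

import Mathlib

open Real MeasureTheory

/-- The dilogarithm `Li₂(z) = -∫₀¹ Log(1 - z t)/t dt`. -/
noncomputable def Li2 (z : ℂ) : ℂ :=
  -∫ t in (0:ℝ)..1, Complex.log (1 - z * (t : ℂ)) / (t : ℂ)

lemma norm_sinh_sq_aux (v ε : ℝ) :
    ‖Complex.sinh ((v : ℂ) + (ε : ℂ) * Complex.I)‖ ^ 2 = Real.sinh v ^ 2 + Real.sin ε ^ 2 := by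
  have h : Complex.sinh ((v : ℂ) + (ε : ℂ) * Complex.I)
      = ((Real.sinh v * Real.cos ε : ℝ) : ℂ) + ((Real.cosh v * Real.sin ε : ℝ) : ℂ) * Complex.I := by
    rw [Complex.sinh_add, Complex.sinh_mul_I, Complex.cosh_mul_I]
    push_cast; ring
  rw [h, Complex.sq_norm, Complex.normSq_add_mul_I]
  have h1 := Real.cosh_sq v
  have h2 := Real.sin_sq_add_cos_sq ε
  have h3 : Real.cos ε ^ 2 = 1 - Real.sin ε ^ 2 := by linarith
  rw [mul_pow, mul_pow, h1, h3]; ring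

lemma norm_sinh_ge_sin (v ε : ℝ) :
    |Real.sin ε| * (Real.exp |v| / 2) ≤ ‖Complex.sinh ((v : ℂ) + (ε : ℂ) * Complex.I)‖ := by
  have h0 : Real.exp |v| / 2 ≤ Real.cosh v := by
    rw [← Real.cosh_abs, Real.cosh_eq]
    have := Real.exp_pos (-|v|)
    linarith
  have h1 : |Real.sin ε| * Real.cosh v ≤ ‖Complex.sinh ((v : ℂ) + (ε : ℂ) * Complex.I)‖ := by
    apply le_of_sq_le_sq _ (norm_nonneg _)
    rw [norm_sinh_sq_aux, mul_pow, sq_abs, Real.cosh_sq]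
    have h2 := Real.sin_sq_le_one ε
    nlinarith [sq_nonneg (Real.sinh v)]
  exact le_trans (mul_le_mul_of_nonneg_left h0 (abs_nonneg _)) h1

lemma norm_sinh_ge_sinh (v ε : ℝ) :
    Real.sinh |v| ≤ ‖Complex.sinh ((v : ℂ) + (ε : ℂ) * Complex.I)‖ := by
  apply le_of_sq_le_sq _ (norm_nonneg _)
  rw [norm_sinh_sq_aux]
  have : Real.sinh |v| ^ 2 = Real.sinh v ^ 2 := by
    rcases abs_choice v with h | h <;> rw [h]
    rw [Real.sinh_neg, neg_sq]
  rw [this]; nlinarith [sq_nonneg (Real.sin ε)]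

lemma norm_exp_aux (y : ℂ) (v ε : ℝ) :
    ‖Complex.exp (-Complex.I * y * ((v : ℂ) + (ε : ℂ) * Complex.I) / (π : ℂ))‖
      = Real.exp ((y.im * v + y.re * ε) / π) := by
  rw [Complex.norm_exp, Complex.div_ofReal_re]
  congr 2
  simp
  ring
  
lemma integrable_exp_neg_abs_aux {c : ℝ} (hc : 0 < c) :
    Integrable (fun v : ℝ => Real.exp (-(c * |v|))) := by
  rw [← integrableOn_univ, ← Set.Iic_union_Ioi (a := (0:ℝ))]
  refine IntegrableOn.union ?_ ?_
  · refine (integrableOn_exp_mul_Iic hc 0).congr_fun (fun x hx => ?_) measurableSet_Iic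
    rw [Set.mem_Iic] at hx
    simp only [abs_of_nonpos hx]
    congr 1; ring
  · refine (exp_neg_integrableOn_Ioi 0 hc).congr_fun (fun x hx => ?_) measurableSet_Ioi
    rw [Set.mem_Ioi] at hx
    simp only [abs_of_pos hx]
    congr 1; ring

lemma sinh_ne_aux {ε : ℝ} (hs : Real.sin ε ≠ 0) (v : ℝ) :
    Complex.sinh ((v : ℂ) + (ε : ℂ) * Complex.I) ≠ 0 := by
  intro h
  have := norm_sinh_ge_sin v ε
  rw [h, norm_zero] at this
  have : 0 < |Real.sin ε| * (Real.exp |v| / 2) := by positivity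
  linarith

lemma cont_aux (y : ℂ) {ε : ℝ} (hs : Real.sin ε ≠ 0) :
    Continuous (fun v : ℝ => Complex.exp (-Complex.I * y * ((v : ℂ) + (ε : ℂ) * Complex.I) / (π : ℂ)) /
        Complex.sinh ((v : ℂ) + (ε : ℂ) * Complex.I)) := by
  refine Continuous.div ?_ ?_ (sinh_ne_aux hs)
  · fun_prop
  · fun_prop

lemma norm_bound_aux (y : ℂ) {ε : ℝ} (hs : Real.sin ε ≠ 0) (v : ℝ) :
    ‖Complex.exp (-Complex.I * y * ((v : ℂ) + (ε : ℂ) * Complex.I) / (π : ℂ)) /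
        Complex.sinh ((v : ℂ) + (ε : ℂ) * Complex.I)‖ ≤
      (Real.exp (y.re * ε / π) * (2 / |Real.sin ε|)) * Real.exp (-((1 - |y.im| / π) * |v|)) := by
  rw [norm_div, norm_exp_aux]
  have hpos : 0 < |Real.sin ε| * (Real.exp |v| / 2) := by positivity
  have h1 : Real.exp ((y.im * v + y.re * ε) / π) ≤ Real.exp ((|y.im| * |v| + y.re * ε) / π) := by
    have := le_abs_self (y.im * v)
    rw [abs_mul] at this
    gcongr
  calc _ ≤ Real.exp ((|y.im| * |v| + y.re * ε) / π) / (|Real.sin ε| * (Real.exp |v| / 2)) := by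
        gcongr
        exact norm_sinh_ge_sin v ε
    _ = _ := by
        have e1 : (|y.im| * |v| + y.re * ε) / π = y.re * ε / π + -((1 - |y.im| / π) * |v|) + |v| := by
          field_simp; ring
        rw [e1, Real.exp_add, Real.exp_add]
        field_simp

lemma integrable_G (y : ℂ) (hy : |y.im| < π) {ε : ℝ} (hs : Real.sin ε ≠ 0) :
    Integrable (fun v : ℝ => Complex.exp (-Complex.I * y * ((v : ℂ) + (ε : ℂ) * Complex.I) / (π : ℂ)) /
        Complex.sinh ((v : ℂ) + (ε : ℂ) * Complex.I)) := by
  have hc : 0 < 1 - |y.im| / π := by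
    rw [sub_pos, div_lt_one pi_pos]; exact hy
  exact ((integrable_exp_neg_abs_aux hc).const_mul _).mono' (cont_aux y hs).aestronglyMeasurable
    (Filter.Eventually.of_forall (norm_bound_aux y hs))

/-- Value of the integral at `y = 0`. -/
lemma integral_S {ε : ℝ} (hε : ε ∈ Set.Ioo 0 π) :
    (∫ v : ℝ, 1 / Complex.sinh ((v : ℂ) + (ε : ℂ) * Complex.I)) = -(Complex.I * π) := by
  have hsin : 0 < Real.sin ε := Real.sin_pos_of_pos_of_lt_pi hε.1 hε.2
  have hint : Integrable (fun v : ℝ => 1 / Complex.sinh ((v : ℂ) + (ε : ℂ) * Complex.I)) := by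
    have := integrable_G 0 (by simpa using pi_pos) hsin.ne'
    simpa using this
  -- a := exp w
  let E : ℝ → ℂ := fun v => Complex.exp ((v : ℂ) + (ε : ℂ) * Complex.I)
  have hE : ∀ v, E v = (Real.exp v : ℂ) * (Complex.cos ε + Complex.sin ε * Complex.I) := by
    intro v
    simp only [E]
    rw [Complex.exp_add, Complex.exp_mul_I]; push_cast; rfl
  have hEim : ∀ v, (E v).im = Real.exp v * Real.sin ε := by
    intro v
    rw [hE, Complex.im_ofReal_mul] <;> simp [← Complex.ofReal_cos, ← Complex.ofReal_sin]
  have hEimpos : ∀ v, 0 < (E v).im := by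
    intro v; rw [hEim]; positivity
  have hp : ∀ v, E v + 1 ≠ 0 := by
    intro v h
    have := hEimpos v
    have h2 := congrArg Complex.im h
    simp at h2; linarith
  have hm : ∀ v, E v - 1 ≠ 0 := by
    intro v h
    have := hEimpos v
    have h2 := congrArg Complex.im h
    simp at h2; linarith
  have hE0 : ∀ v, E v ≠ 0 := fun v => Complex.exp_ne_zero _
  let T : ℝ → ℂ := fun v => -Complex.I * ((E v - 1) / (E v + 1))
  have hTre : ∀ v, 0 < (T v).re := by
    intro v
    have h1 : (T v).re = 2 * (E v).im / Complex.normSq (E v + 1) := by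
      simp only [T]
      simp [Complex.div_im]
      ring
    rw [h1]
    have := hEimpos v
    have := Complex.normSq_pos.2 (hp v)
    positivity
  have hTs : ∀ v, T v ∈ Complex.slitPlane := fun v => Or.inl (hTre v)
  have hdE : ∀ v, HasDerivAt E (E v) v := by
    intro v
    have h1 : HasDerivAt (fun v : ℝ => (v : ℂ) + (ε : ℂ) * Complex.I) 1 v :=
      (Complex.ofRealCLM.hasDerivAt).add_const _
    simpa using h1.cexp
  have hdT : ∀ v, HasDerivAt T (-Complex.I * ((E v * (E v + 1) - (E v - 1) * E v) / (E v + 1) ^ 2)) v := by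
    intro v
    exact (((hdE v).sub_const 1).div ((hdE v).add_const 1) (hp v)).const_mul _
  have hd : ∀ v : ℝ, HasDerivAt (fun v => Complex.log (T v))
      (1 / Complex.sinh ((v : ℂ) + (ε : ℂ) * Complex.I)) v := by
    intro v
    have h1 := (hdT v).clog_real (hTs v)
    convert h1 using 1
    have h2 : Complex.sinh ((v : ℂ) + (ε : ℂ) * Complex.I) = (E v - (E v)⁻¹) / 2 := by
      simp only [E]; rw [← Complex.exp_neg]; rfl
    rw [h2]
    have a1 := hp v
    have a2 := hm v
    have a3 := hE0 v
    have a4 : E v - (E v)⁻¹ = (E v - 1) * (E v + 1) / E v := by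
      field_simp; ring
    rw [a4]
    simp only [T]
    have := Complex.I_ne_zero
    field_simp
    ring
  have htop : Filter.Tendsto (fun v => Complex.log (T v)) Filter.atTop (nhds (Complex.log (-Complex.I))) := by
    refine Filter.Tendsto.clog ?_ (by simp [Complex.mem_slitPlane_iff])
    have hinv : Filter.Tendsto (fun v => (E v)⁻¹) Filter.atTop (nhds 0) := by
      rw [tendsto_zero_iff_norm_tendsto_zero]
      have : ∀ v, ‖(E v)⁻¹‖ = Real.exp (-v) := by
        intro v; simp [E, Complex.norm_exp, Real.exp_neg]
      simp only [this]
      exact Real.tendsto_exp_neg_atTop_nhds_zero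
    have h1 : ∀ v, T v = -Complex.I * ((1 - (E v)⁻¹) / (1 + (E v)⁻¹)) := by
      intro v
      have a1 := hp v
      have a3 := hE0 v
      simp only [T]
      congr 1
      have : 1 + (E v)⁻¹ = (E v + 1) / E v := by field_simp
      rw [this]
      field_simp
    have h2 : Filter.Tendsto (fun v => -Complex.I * ((1 - (E v)⁻¹) / (1 + (E v)⁻¹))) Filter.atTop
      (nhds (-Complex.I * ((1 - 0) / (1 + 0)))) := by
      refine Filter.Tendsto.const_mul _ (Filter.Tendsto.div ?_ ?_ (by simp))
      · exact hinv.const_sub _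
      · exact hinv.const_add _
    rw [show T = _ from funext h1]
    simpa using h2
  have hbot : Filter.Tendsto (fun v => Complex.log (T v)) Filter.atBot (nhds (Complex.log (Complex.I))) := by
    refine Filter.Tendsto.clog ?_ (by simp [Complex.mem_slitPlane_iff])
    have hinv : Filter.Tendsto (fun v => (E v)) Filter.atBot (nhds 0) := by
      rw [tendsto_zero_iff_norm_tendsto_zero]
      have : ∀ v, ‖(E v)‖ = Real.exp (v) := by
        intro v; simp [E, Complex.norm_exp]
      simp only [this]
      exact Real.tendsto_exp_atBot
    have h2 : Filter.Tendsto T Filter.atBot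
      (nhds (-Complex.I * ((0 - 1) / (0 + 1)))) := by
      refine Filter.Tendsto.const_mul _ (Filter.Tendsto.div ?_ ?_ (by simp))
      · exact hinv.sub_const _
      · exact hinv.add_const _
    simpa using h2
  rw [integral_of_hasDerivAt_of_tendsto hd hint hbot htop, Complex.log_I, Complex.log_neg_I]
  ring

lemma rect_shift (H : ℂ → ℂ) (a b : ℝ) 
    (hd : ∀ z : ℂ, z.im ∈ Set.uIcc a b → DifferentiableAt ℂ H z)
    (ha : Integrable (fun v : ℝ => H (v + a * Complex.I)))
    (hb : Integrable (fun v : ℝ => H (v + b * Complex.I)))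
    (B : ℝ → ℝ) (hB : Filter.Tendsto B Filter.atTop (nhds 0))
    (hbd : ∀ᶠ R in Filter.atTop, ∀ v t : ℝ, |v| = R → t ∈ Set.uIcc a b →
      ‖H (v + t * Complex.I)‖ ≤ B R) :
    (∫ v : ℝ, H (v + a * Complex.I)) = ∫ v : ℝ, H (v + b * Complex.I) := by
  have h1 := intervalIntegral_tendsto_integral ha Filter.tendsto_neg_atTop_atBot Filter.tendsto_id
  have h2 := intervalIntegral_tendsto_integral hb Filter.tendsto_neg_atTop_atBot Filter.tendsto_id
  have h3 : Filter.Tendsto (fun R : ℝ => (∫ v in (-R)..R, H (v + a * Complex.I)) -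
      ∫ v in (-R)..R, H (v + b * Complex.I)) Filter.atTop (nhds 0) := by
    have hB2 : Filter.Tendsto (fun R => B R * |b - a| + B R * |b - a|) Filter.atTop (nhds 0) := by
      simpa using (hB.mul_const |b - a|).add (hB.mul_const |b - a|)
    refine squeeze_zero_norm' ?_ hB2
    filter_upwards [hbd, Filter.eventually_ge_atTop 0] with R hR hR0
    have key := Complex.integral_boundary_rect_eq_zero_of_differentiableOn H
      ((-R : ℝ) + a * Complex.I) ((R : ℝ) + b * Complex.I) (by
        intro z hz
        refine (hd z ?_).differentiableWithinAt
        have := hz.2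
        simpa using this)
    simp only [Complex.add_re, Complex.ofReal_re, Complex.mul_re, Complex.I_re, mul_zero,
      Complex.ofReal_im, Complex.I_im, mul_one, sub_zero, add_zero, zero_add, Complex.add_im,
      Complex.mul_im, sub_self, smul_eq_mul] at key
    have e : (∫ v in (-R)..R, H (v + a * Complex.I)) - (∫ v in (-R)..R, H (v + b * Complex.I))
        = Complex.I * (∫ t in a..b, H ((-R : ℝ) + t * Complex.I)) -
          Complex.I * (∫ t in a..b, H ((R : ℝ) + t * Complex.I)) := by
      linear_combination key
    rw [e]
    refine (norm_sub_le _ _).trans ?_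
    rw [norm_mul, norm_mul, Complex.norm_I, one_mul, one_mul]
    refine add_le_add ?_ ?_
    · refine intervalIntegral.norm_integral_le_of_norm_le_const (fun t ht => hR _ _ ?_ (Set.uIoc_subset_uIcc ht))
      rw [abs_neg, abs_of_nonneg hR0]
    · refine intervalIntegral.norm_integral_le_of_norm_le_const (fun t ht => hR _ _ ?_ (Set.uIoc_subset_uIcc ht))
      rw [abs_of_nonneg hR0]
  have h4 := tendsto_nhds_unique (h1.sub h2) h3
  exact sub_eq_zero.1 h4

lemma sin_zero_aux {t : ℝ} (h0 : 0 < t) (h1 : t < 2 * π) (h : Real.sin t = 0) : t = π := by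
  have h2 : Real.sin (t - π) = 0 := by rw [Real.sin_sub_pi, h, neg_zero]
  have := (Real.sin_eq_zero_iff_of_lt_of_lt (by linarith) (by linarith)).1 h2
  linarith

lemma sinh_zero_aux {w : ℂ} (h0 : 0 < w.im) (h1 : w.im < 2 * π) (h : Complex.sinh w = 0) :
    w = π * Complex.I := by
  have h2 := norm_sinh_sq_aux w.re w.im
  rw [Complex.re_add_im, h, norm_zero] at h2
  have h3 : Real.sinh w.re = 0 := by nlinarith [sq_nonneg (Real.sinh w.re), sq_nonneg (Real.sin w.im)]
  have h4 : Real.sin w.im = 0 := by nlinarith [sq_nonneg (Real.sinh w.re), sq_nonneg (Real.sin w.im)]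
  have h5 := Real.sinh_eq_zero.1 h3
  have h6 := sin_zero_aux h0 h1 h4
  apply Complex.ext <;> simp [h5, h6]

lemma sinh_ge_aux {R : ℝ} (hR : 1 ≤ R) : Real.exp R / 4 ≤ Real.sinh R := by
  rw [Real.sinh_eq]
  have h1 : 2 ≤ Real.exp R := by linarith [Real.add_one_le_exp R]
  have h2 : Real.exp (-R) ≤ 1 := by rw [Real.exp_le_one_iff]; linarith
  linarith

lemma one_add_exp_slit {y : ℂ} (hy : |y.im| < π) : 1 + Complex.exp y ∈ Complex.slitPlane := by
  rw [Complex.mem_slitPlane_iff]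
  by_cases h : y.im = 0
  · left
    rw [Complex.add_re, Complex.exp_re, h]
    simp; positivity
  · right
    rw [Complex.add_im, Complex.exp_im]
    rw [abs_lt] at hy
    have h2 : Real.sin y.im ≠ 0 := by
      intro h3
      exact h ((Real.sin_eq_zero_iff_of_lt_of_lt hy.1 hy.2).1 h3)
    simp [h2]

lemma integral_G (y : ℂ) (hy : |y.im| < π) {ε : ℝ} (hε : ε ∈ Set.Ioo 0 π) :
    (∫ v : ℝ, Complex.exp (-Complex.I * y * ((v : ℂ) + (ε : ℂ) * Complex.I) / (π : ℂ)) /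
        Complex.sinh ((v : ℂ) + (ε : ℂ) * Complex.I)) =
      -(2 * π * Complex.I) * (Complex.exp y / (1 + Complex.exp y)) := by
  have hpi := pi_pos
  have hpiC : (π : ℂ) ≠ 0 := by exact_mod_cast hpi.ne'
  have hsin : 0 < Real.sin ε := Real.sin_pos_of_pos_of_lt_pi hε.1 hε.2
  have hsin2 : Real.sin (ε + π) ≠ 0 := by rw [Real.sin_add_pi]; linarith
  have hiS : Integrable (fun v : ℝ => 1 / Complex.sinh ((v : ℂ) + (ε : ℂ) * Complex.I)) := by
    have := integrable_G 0 (by simpa using pi_pos) hsin.ne'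
    simpa using this
  have hiG := integrable_G y hy hsin.ne'
  set p : ℂ := π * Complex.I with hp
  let f : ℂ → ℂ := fun w => Complex.exp (-Complex.I * y * w / (π : ℂ)) - Complex.exp y
  let H : ℂ → ℂ := fun w => dslope f p w / dslope Complex.sinh p w
  have hfp : f p = 0 := by
    simp only [f, hp]
    rw [show -Complex.I * y * (π * Complex.I) / (π : ℂ) = y by
      field_simp; rw [Complex.I_sq]; ring]
    simp
  have hsp : Complex.sinh p = 0 := by rw [hp, Complex.sinh_mul_I]; simp
  have hH : ∀ w, w ≠ p → H w = f w / Complex.sinh w := by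
    intro w hw
    simp only [H]
    rw [dslope_of_ne _ hw, dslope_of_ne _ hw, slope_def_field, slope_def_field, hfp, hsp, sub_zero, sub_zero]
    have : w - p ≠ 0 := sub_ne_zero.2 hw
    rw [div_div_div_cancel_right₀ this]
  have hne : ∀ (v t : ℝ), Real.sin t ≠ 0 → (v : ℂ) + t * Complex.I ≠ p := by
    intro v t ht h
    have := congrArg Complex.im h
    simp [hp] at this
    rw [this] at ht
    simp at ht
  have hne2 : ∀ (v t : ℝ), v ≠ 0 → (v : ℂ) + t * Complex.I ≠ p := by
    intro v t ht h
    have := congrArg Complex.re h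
    simp [hp] at this
    exact ht this
  have hline1 : ∀ v : ℝ, H (v + ε * Complex.I) =
      Complex.exp (-Complex.I * y * ((v : ℂ) + (ε : ℂ) * Complex.I) / (π : ℂ)) /
        Complex.sinh ((v : ℂ) + (ε : ℂ) * Complex.I)
        - Complex.exp y * (1 / Complex.sinh ((v : ℂ) + (ε : ℂ) * Complex.I)) := by
    intro v
    rw [hH _ (hne v ε hsin.ne')]
    simp only [f]; ring
  have hline2 : ∀ v : ℝ, H (v + (ε + π : ℝ) * Complex.I) =
      -(Complex.exp y * (Complex.exp (-Complex.I * y * ((v : ℂ) + (ε : ℂ) * Complex.I) / (π : ℂ)) /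
        Complex.sinh ((v : ℂ) + (ε : ℂ) * Complex.I))
        - Complex.exp y * (1 / Complex.sinh ((v : ℂ) + (ε : ℂ) * Complex.I))) := by
    intro v
    rw [hH _ (hne v _ hsin2)]
    have e1 : (v : ℂ) + (ε + π : ℝ) * Complex.I = (v + ε * Complex.I) + π * Complex.I := by
      push_cast; ring
    have e2 : Complex.sinh ((v + ε * Complex.I) + π * Complex.I)
        = - Complex.sinh (v + ε * Complex.I) := by
      rw [Complex.sinh_add, Complex.sinh_mul_I, Complex.cosh_mul_I]; simp
    have e3 : -Complex.I * y * ((v + ε * Complex.I) + π * Complex.I) / (π : ℂ)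
        = y + -Complex.I * y * (v + ε * Complex.I) / (π : ℂ) := by
      field_simp; linear_combination (-π * y) * Complex.I_sq
    rw [e1, e2]
    simp only [f]
    rw [e3, Complex.exp_add]
    rw [div_neg]; ring
  have hi1 : Integrable (fun v : ℝ => H (v + ε * Complex.I)) := by
    simp only [hline1]
    exact hiG.sub (hiS.const_mul _)
  have hi2 : Integrable (fun v : ℝ => H (v + (ε + π : ℝ) * Complex.I)) := by
    simp only [hline2]
    exact ((hiG.const_mul _).sub (hiS.const_mul _)).neg
  have hIcc : ∀ t, t ∈ Set.uIcc ε (ε + π) → 0 < t ∧ t < 2 * π := by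
    intro t ht
    rw [Set.uIcc_of_le (by linarith)] at ht
    exact ⟨by linarith [ht.1, hε.1], by linarith [ht.2, hε.2]⟩
  have hfd : Differentiable ℂ f := by
    simp only [f]; fun_prop
  have hsd : Differentiable ℂ Complex.sinh := Complex.differentiable_sinh
  have hfd' : Differentiable ℂ (dslope f p) := by
    rw [← differentiableOn_univ] at hfd ⊢
    exact (Complex.differentiableOn_dslope Filter.univ_mem).2 hfd
  have hsd' : Differentiable ℂ (dslope Complex.sinh p) := by
    rw [← differentiableOn_univ] at hsd ⊢
    exact (Complex.differentiableOn_dslope Filter.univ_mem).2 hsd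
  have hshift := rect_shift H ε (ε + π) (by
      intro z hz
      obtain ⟨h0, h1⟩ := hIcc _ hz
      refine (hfd' z).div (hsd' z) ?_
      by_cases hzp : z = p
      · rw [hzp, dslope_same, Complex.deriv_sinh, hp, Complex.cosh_mul_I]
        simp
      · rw [dslope_of_ne _ hzp, slope_def_field, hsp, sub_zero]
        refine div_ne_zero (fun h => hzp (sinh_zero_aux h0 h1 h)) (sub_ne_zero.2 hzp))
    hi1 hi2
    (fun R => 4 * (Real.exp (2 * |y.re|) + Real.exp y.re) * Real.exp (-((1 - |y.im| / π) * R)))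
    (by
      have hc : 0 < 1 - |y.im| / π := by
        rw [sub_pos, div_lt_one pi_pos]; exact hy
      have : Filter.Tendsto (fun R : ℝ => Real.exp (-((1 - |y.im| / π) * R))) Filter.atTop (nhds 0) :=
        Real.tendsto_exp_neg_atTop_nhds_zero.comp (Filter.tendsto_id.const_mul_atTop hc)
      simpa using this.const_mul (4 * (Real.exp (2 * |y.re|) + Real.exp y.re)))
    (by
      filter_upwards [Filter.eventually_ge_atTop 1] with R hR v t hv ht
      obtain ⟨h0, h1⟩ := hIcc _ ht
      have hv0 : v ≠ 0 := by
        rintro rfl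
        simp at hv; linarith
      rw [hH _ (hne2 v t hv0), norm_div]
      have hs1 : Real.exp R / 4 ≤ ‖Complex.sinh ((v : ℂ) + (t : ℂ) * Complex.I)‖ :=
        (sinh_ge_aux hR).trans (hv ▸ norm_sinh_ge_sinh v t)
      have hf1 : ‖f (v + t * Complex.I)‖ ≤ (Real.exp (2 * |y.re|) + Real.exp y.re) * Real.exp (|y.im| / π * R) := by
        refine (norm_sub_le _ _).trans ?_
        rw [norm_exp_aux, Complex.norm_exp, add_mul]
        refine add_le_add ?_ ?_
        · rw [← Real.exp_add]
          apply Real.exp_le_exp.2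
          rw [add_div, add_comm]
          refine add_le_add ?_ ?_
          · rw [div_le_iff₀ hpi]
            calc y.re * t ≤ |y.re| * t := by gcongr; exact le_abs_self _
              _ ≤ |y.re| * (2 * π) := by gcongr
              _ = _ := by ring
          · rw [div_mul_eq_mul_div]
            have := le_abs_self (y.im * v)
            rw [abs_mul, hv] at this
            gcongr
        · refine le_mul_of_one_le_right (Real.exp_pos _).le ?_
          rw [Real.one_le_exp_iff]
          positivity
      calc _ ≤ ((Real.exp (2 * |y.re|) + Real.exp y.re) * Real.exp (|y.im| / π * R)) / (Real.exp R / 4) := by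
            gcongr
        _ = _ := by
          rw [show |y.im| / π * R = -((1 - |y.im| / π) * R) + R by ring, Real.exp_add]
          field_simp)
  simp only [hline1, hline2] at hshift
  rw [integral_neg, integral_sub hiG (hiS.const_mul _), integral_sub (hiG.const_mul _) (hiS.const_mul _),
    integral_const_mul, integral_const_mul, integral_S hε] at hshift
  have h1 := Complex.slitPlane_ne_zero (one_add_exp_slit hy)
  rw [← mul_div_assoc, eq_div_iff h1]
  linear_combination hshift

lemma s_exp_bound {c s : ℝ} (hc : 0 < c) : s * Real.exp (-(c * s)) ≤ (2 / c) * Real.exp (-(c / 2 * s)) := by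
  have h1 : c / 2 * s ≤ Real.exp (c / 2 * s) := by linarith [Real.add_one_le_exp (c / 2 * s)]
  have h2 : s ≤ 2 / c * Real.exp (c / 2 * s) := by
    calc s = 2 / c * (c / 2 * s) := by field_simp
      _ ≤ _ := by gcongr
  calc s * Real.exp (-(c * s)) ≤ (2 / c * Real.exp (c / 2 * s)) * Real.exp (-(c * s)) := by gcongr
    _ = _ := by rw [mul_assoc, ← Real.exp_add]; congr 2; ring

lemma tendsto_exp_aux {c : ℝ} (hc : 0 < c) :
    Filter.Tendsto (fun R : ℝ => Real.exp (-(c * R))) Filter.atTop (nhds 0) :=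
  Real.tendsto_exp_neg_atTop_nhds_zero.comp (Filter.tendsto_id.const_mul_atTop hc)

lemma norm_s_exp {a : ℂ} {s : ℝ} (hs : 0 ≤ s) :
    ‖(s : ℂ) * Complex.exp (-(a * s))‖ = s * Real.exp (-(a.re * s)) := by
  rw [norm_mul, Complex.norm_exp, Complex.norm_of_nonneg hs]; simp

lemma integrable_s_exp {a : ℂ} (ha : 0 < a.re) :
    IntegrableOn (fun s : ℝ => (s : ℂ) * Complex.exp (-(a * s))) (Set.Ioi 0) := by
  have h := ((exp_neg_integrableOn_Ioi 0 (half_pos ha)).const_mul (2 / a.re))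
  refine h.mono' (Continuous.aestronglyMeasurable (by fun_prop)) ?_
  refine (ae_restrict_iff' measurableSet_Ioi).2 (Filter.Eventually.of_forall fun s hs => ?_)
  rw [norm_s_exp (le_of_lt hs), neg_mul]
  exact s_exp_bound ha

lemma integral_s_exp {a : ℂ} (ha : 0 < a.re) :
    ∫ s in Set.Ioi (0 : ℝ), (s : ℂ) * Complex.exp (-(a * s)) = 1 / a ^ 2 := by
  have ha0 : a ≠ 0 := by rintro rfl; simp at ha
  have hd : ∀ s : ℝ, HasDerivAt (fun s : ℝ => -(1 / a) * ((s : ℂ) * Complex.exp (-(a * s)))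
      - (1 / a ^ 2) * Complex.exp (-(a * s))) ((s : ℂ) * Complex.exp (-(a * s))) s := by
    intro s
    have h1 : HasDerivAt (fun s : ℝ => (s : ℂ)) 1 s := Complex.ofRealCLM.hasDerivAt
    have h2 : HasDerivAt (fun s : ℝ => Complex.exp (-(a * s))) (Complex.exp (-(a * s)) * (-(a * 1))) s :=
      ((h1.const_mul a).neg).cexp
    have h3 := ((h1.mul h2).const_mul (-(1 / a))).sub (h2.const_mul (1 / a ^ 2))
    refine HasDerivAt.congr_deriv h3 ?_
    field_simp
    ring
  have t2 : Filter.Tendsto (fun s : ℝ => Complex.exp (-(a * s))) Filter.atTop (nhds 0) := by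
    rw [tendsto_zero_iff_norm_tendsto_zero]
    have : ∀ s : ℝ, ‖Complex.exp (-(a * s))‖ = Real.exp (-(a.re * s)) := by
      intro s; rw [Complex.norm_exp]; simp
    simp only [this]
    exact tendsto_exp_aux ha
  have t1 : Filter.Tendsto (fun s : ℝ => (s : ℂ) * Complex.exp (-(a * s))) Filter.atTop (nhds 0) := by
    have h := (tendsto_exp_aux (half_pos ha)).const_mul (2 / a.re)
    rw [mul_zero] at h
    refine squeeze_zero_norm' ?_ h
    filter_upwards [Filter.eventually_ge_atTop 0] with s hs
    rw [norm_s_exp hs]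
    exact s_exp_bound ha
  have t := (t1.const_mul (-(1 / a))).sub (t2.const_mul (1 / a ^ 2))
  rw [integral_Ioi_of_hasDerivAt_of_tendsto' (fun s _ => hd s) (integrable_s_exp ha) t]
  simp

lemma sub_im_aux {y : ℂ} (hy : |y.im| < π) (s : ℝ) : |(y - s).im| < π := by
  simpa using hy

lemma log_bound_aux (y : ℂ) : ∀ᶠ s : ℝ in Filter.atTop,
    ‖Complex.log (1 + Complex.exp (y - s))‖ ≤ (3 / 2 * Real.exp y.re) * Real.exp (-(1 * s)) := by
  have h1 : ∀ s : ℝ, ‖Complex.exp (y - s)‖ = Real.exp y.re * Real.exp (-(1 * s)) := by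
    intro s; rw [Complex.norm_exp, ← Real.exp_add]; simp [sub_eq_add_neg]
  have h2 := (tendsto_exp_aux one_pos).const_mul (Real.exp y.re)
  rw [mul_zero] at h2
  filter_upwards [h2.eventually_le_const (show (0:ℝ) < 1 / 2 by norm_num)] with s hs
  have := Complex.norm_log_one_add_half_le_self (z := Complex.exp (y - s)) (by rw [h1]; exact hs)
  rw [h1] at this
  linarith

lemma hasDerivAt_L {y : ℂ} (hy : |y.im| < π) (s : ℝ) :
    HasDerivAt (fun s : ℝ => Complex.log (1 + Complex.exp (y - s)))
      (-(Complex.exp (y - s) / (1 + Complex.exp (y - s)))) s := by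
  have h1 : HasDerivAt (fun s : ℝ => (s : ℂ)) 1 s := Complex.ofRealCLM.hasDerivAt
  have h2 := ((h1.const_sub y).cexp.const_add 1).clog_real (one_add_exp_slit (sub_im_aux hy s))
  convert h2 using 1
  ring

lemma integrable_L {y : ℂ} (hy : |y.im| < π) :
    IntegrableOn (fun s : ℝ => Complex.log (1 + Complex.exp (y - s))) (Set.Ioi 0) := by
  have hc : Continuous (fun s : ℝ => Complex.log (1 + Complex.exp (y - s))) :=
    continuous_iff_continuousAt.2 fun s => (hasDerivAt_L hy s).continuousAt
  refine (integrable_norm_iff hc.aestronglyMeasurable).1 ?_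
  refine integrable_of_isBigO_exp_neg one_pos hc.norm.continuousOn ?_
  refine Asymptotics.IsBigO.of_bound (3 / 2 * Real.exp y.re) ?_
  filter_upwards [log_bound_aux y] with s hs
  rw [norm_norm, Real.norm_of_nonneg (Real.exp_pos _).le, neg_mul]
  exact hs

lemma by_parts {y : ℂ} (hy : |y.im| < π)
    (hi : IntegrableOn (fun s : ℝ => (s : ℂ) * (Complex.exp (y - s) / (1 + Complex.exp (y - s)))) (Set.Ioi 0)) :
    ∫ s in Set.Ioi (0 : ℝ), (s : ℂ) * (Complex.exp (y - s) / (1 + Complex.exp (y - s))) =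
      ∫ s in Set.Ioi (0 : ℝ), Complex.log (1 + Complex.exp (y - s)) := by
  have hd : ∀ s : ℝ, HasDerivAt (fun s : ℝ => (s : ℂ) * Complex.log (1 + Complex.exp (y - s)))
      (Complex.log (1 + Complex.exp (y - s)) - 
        (s : ℂ) * (Complex.exp (y - s) / (1 + Complex.exp (y - s)))) s := by
    intro s
    have h1 : HasDerivAt (fun s : ℝ => (s : ℂ)) 1 s := Complex.ofRealCLM.hasDerivAt
    refine HasDerivAt.congr_deriv (h1.mul (hasDerivAt_L hy s)) ?_
    ring
  have t : Filter.Tendsto (fun s : ℝ => (s : ℂ) * Complex.log (1 + Complex.exp (y - s)))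
      Filter.atTop (nhds 0) := by
    have h := (tendsto_exp_aux (half_pos one_pos)).const_mul ((3 / 2 * Real.exp y.re) * (2 / 1))
    rw [mul_zero] at h
    refine squeeze_zero_norm' ?_ h
    filter_upwards [Filter.eventually_ge_atTop 0, log_bound_aux y] with s hs hl
    rw [norm_mul, Complex.norm_of_nonneg hs]
    have := s_exp_bound (s := s) one_pos
    calc _ ≤ s * ((3 / 2 * Real.exp y.re) * Real.exp (-(1 * s))) := by gcongr
      _ = (3 / 2 * Real.exp y.re) * (s * Real.exp (-(1 * s))) := by ring
      _ ≤ (3 / 2 * Real.exp y.re) * (2 / 1 * Real.exp (-(1 / 2 * s))) := by gcongr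
      _ = _ := by ring
  have key := integral_Ioi_of_hasDerivAt_of_tendsto' (a := (0:ℝ)) (fun s _ => hd s)
    ((integrable_L hy).sub hi) t
  rw [integral_sub (integrable_L hy) hi] at key
  simp at key
  exact (sub_eq_zero.1 key).symm

lemma Li2_eq (y : ℂ) :
    Li2 (-Complex.exp y) = -∫ s in Set.Ioi (0 : ℝ), Complex.log (1 + Complex.exp (y - s)) := by
  unfold Li2
  congr 1
  rw [intervalIntegral.integral_of_le zero_le_one, integral_Ioc_eq_integral_Ioo]
  have him : (fun s : ℝ => Real.exp (-s)) '' Set.Ioi 0 = Set.Ioo 0 1 := by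
    ext t
    constructor
    · rintro ⟨s, hs, rfl⟩
      refine ⟨Real.exp_pos _, ?_⟩
      rw [Real.exp_lt_one_iff]
      simpa using hs
    · rintro ⟨h0, h1⟩
      refine ⟨-Real.log t, ?_, ?_⟩
      · simpa using Real.log_neg h0 h1
      · simp [Real.exp_log h0]
  rw [← him, integral_image_eq_integral_abs_deriv_smul (f' := fun s => -Real.exp (-s)) measurableSet_Ioi]
  · refine setIntegral_congr_fun measurableSet_Ioi fun s _ => ?_
    simp only [abs_neg, abs_of_pos (Real.exp_pos _)]
    rw [Complex.real_smul, mul_div_cancel₀]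
    · congr 1
      rw [Complex.exp_sub, Complex.ofReal_exp, Complex.ofReal_neg, Complex.exp_neg]
      ring
    · exact_mod_cast (Real.exp_pos _).ne'
  · intro s _
    have := (hasDerivAt_neg s).exp
    refine HasDerivAt.hasDerivWithinAt ?_
    simpa using this
  · intro s _ t _ h
    simpa using h


/-- integral representation of the dilogarithm: for `|Im y| < π`,
the integral over the contour `ℝ + iε` (with `0 < ε < π`) of
`e^{-iy v/π}/(4 v² sinh v)` converges absolutely and equals
`(-i/(2π)) Li₂(-e^y)`. -/
theorem dilog_integral_representation (y : ℂ) (hy : |y.im| < π)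
    (ε : ℝ) (hε : ε ∈ Set.Ioo 0 π) :
    Integrable (fun v : ℝ =>
      Complex.exp (-Complex.I * y * ((v : ℂ) + (ε : ℂ) * Complex.I) / (π : ℂ)) /
        (4 * ((v : ℂ) + (ε : ℂ) * Complex.I) ^ 2 *
          Complex.sinh ((v : ℂ) + (ε : ℂ) * Complex.I))) ∧
    (∫ v : ℝ,
      Complex.exp (-Complex.I * y * ((v : ℂ) + (ε : ℂ) * Complex.I) / (π : ℂ)) /
        (4 * ((v : ℂ) + (ε : ℂ) * Complex.I) ^ 2 *
          Complex.sinh ((v : ℂ) + (ε : ℂ) * Complex.I))) =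
      (-Complex.I / (2 * (π : ℂ))) * Li2 (-Complex.exp y) := by
  have hpi := pi_pos
  have hpiC : (π : ℂ) ≠ 0 := by exact_mod_cast hpi.ne'
  have hsin : 0 < Real.sin ε := Real.sin_pos_of_pos_of_lt_pi hε.1 hε.2
  have hg := integrable_G y hy hsin.ne'
  have hgc := cont_aux y hsin.ne'
  have hGs : ∀ s : ℝ, _ := fun s => integral_G (y - s) (sub_im_aux hy s) hε
  let g : ℝ → ℂ := fun v => 
    Complex.exp (-Complex.I * y * ((v : ℂ) + (ε : ℂ) * Complex.I) / (π : ℂ)) /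
        Complex.sinh ((v : ℂ) + (ε : ℂ) * Complex.I)
  let a : ℝ → ℂ := fun v => -Complex.I * ((v : ℂ) + (ε : ℂ) * Complex.I) / (π : ℂ)
  have hac : Continuous a := by simp only [a]; fun_prop
  have hare : ∀ v, (a v).re = ε / π := by
    intro v
    simp only [a]
    rw [Complex.div_ofReal_re]; simp
  have hapos : ∀ v, 0 < (a v).re := by
    intro v; rw [hare]; exact div_pos hε.1 hpi
  let K : ℝ → ℝ → ℂ := fun v s => g v * ((s : ℂ) * Complex.exp (-(a v * s)))
  have hKint : Integrable (Function.uncurry K) (volume.prod (volume.restrict (Set.Ioi (0:ℝ)))) := by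
    have hb : Integrable (fun s : ℝ => (s : ℂ) * Complex.exp (-(((ε / π : ℝ) : ℂ) * s)))
        (volume.restrict (Set.Ioi (0:ℝ))) :=
      integrable_s_exp (by simpa using div_pos hε.1 hpi)
    have hprod := (Integrable.mul_prod hg hb)
    refine hprod.mono ?_ ?_
    · refine Continuous.aestronglyMeasurable ?_
      have hgc' : Continuous g := hgc
      simp only [Function.uncurry_def, K]
      fun_prop
    · refine Filter.Eventually.of_forall fun z => ?_
      simp only [Function.uncurry, K, g]
      have e : ‖Complex.exp (-(a z.1 * z.2))‖ = ‖Complex.exp (-(((ε / π : ℝ) : ℂ) * z.2))‖ := by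
        rw [Complex.norm_exp, Complex.norm_exp, Complex.neg_re, Complex.neg_re,
          Complex.re_mul_ofReal, Complex.re_mul_ofReal, hare, Complex.ofReal_re]
      simp only [norm_mul]
      rw [e]
  have hin : ∀ v, ∫ s in Set.Ioi (0:ℝ), K v s = g v * (1 / a v ^ 2) := by
    intro v
    simp only [K]
    rw [integral_const_mul, integral_s_exp (hapos v)]
  have hout : ∀ s : ℝ, ∫ v, K v s = -(2 * π * Complex.I) *
      ((s : ℂ) * (Complex.exp (y - s) / (1 + Complex.exp (y - s)))) := by
    intro s
    have e : ∀ v : ℝ, K v s = s * (Complex.exp (-Complex.I * (y - s) * ((v : ℂ) + (ε : ℂ) * Complex.I) / (π : ℂ)) /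
        Complex.sinh ((v : ℂ) + (ε : ℂ) * Complex.I)) := by
      intro v
      simp only [K, g, a]
      rw [show -Complex.I * (y - s) * ((v : ℂ) + (ε : ℂ) * Complex.I) / (π : ℂ)
        = -Complex.I * y * ((v : ℂ) + (ε : ℂ) * Complex.I) / (π : ℂ) +
          -(-Complex.I * ((v : ℂ) + (ε : ℂ) * Complex.I) / (π : ℂ) * s) by ring, Complex.exp_add]
      ring
    simp only [e]
    rw [integral_const_mul, hGs]
    ring
  have heq : ∀ v : ℝ, Complex.exp (-Complex.I * y * ((v : ℂ) + (ε : ℂ) * Complex.I) / (π : ℂ)) /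
        (4 * ((v : ℂ) + (ε : ℂ) * Complex.I) ^ 2 *
          Complex.sinh ((v : ℂ) + (ε : ℂ) * Complex.I)) =
      -(1 / (4 * π ^ 2)) * ∫ s in Set.Ioi (0:ℝ), K v s := by
    intro v
    rw [hin]
    have h1 := sinh_ne_aux hsin.ne' v
    have h2 : (v : ℂ) + (ε : ℂ) * Complex.I ≠ 0 := by
      intro h
      have := congrArg Complex.im h
      simp at this
      exact hε.1.ne' this
    have h3 : a v ^ 2 = -(((v : ℂ) + (ε : ℂ) * Complex.I) ^ 2 / π ^ 2) := by
      simp only [a]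
      rw [div_pow, mul_pow, neg_sq, Complex.I_sq]; ring
    rw [h3]
    simp only [g]
    field_simp
  have hswap := integral_integral_swap hKint
  have hsi : Integrable (fun s : ℝ => (s : ℂ) * (Complex.exp (y - s) / (1 + Complex.exp (y - s))))
      (volume.restrict (Set.Ioi (0:ℝ))) := by
    have h := hKint.integral_prod_right
    simp only [Function.uncurry, hout] at h
    have h2 := h.const_mul (-(2 * π * Complex.I))⁻¹
    refine h2.congr (Filter.Eventually.of_forall fun s => ?_)
    have : -(2 * π * Complex.I) ≠ 0 := by simp [hpiC]
    simp only
    rw [inv_mul_cancel_left₀ this]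
  simp only [heq]
  refine ⟨(hKint.integral_prod_left).const_mul _, ?_⟩
  rw [integral_const_mul, hswap]
  simp only [hout]
  rw [integral_const_mul, by_parts hy hsi, Li2_eq]
  field_simp
  norm_num
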